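/- Let F be a forest with r components, minimum degree δ(F) = 1, and s edges. Then q(K_1 ∨ F) ≤ q(K_1 ∨ (S_{s−r+2} ∪ (r−1)P_2)), with equality if and only if F is isomorphic to S_{s−r+2} ∪ (r−1)P_2. -/

import Mathlib

namespace QPaper

open SimpleGraph

/-- The signless Laplacian matrix `Q(G) = D(G) + A(G)` of a graph, over `ℝ`. -/
noncomputable def signlessLap {V : Type*} [Fintype V] [DecidableEq V] (G : SimpleGraph V) :
    Matrix V V ℝ :=
  letI := Classical.decRel G.Adj
  G.degMatrix ℝ + G.adjMatrix ℝ

/-- The `Q`-index of a graph: the largest eigenvalue of its signless Laplacian matrix. -/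
noncomputable def qIndex {V : Type*} [Fintype V] [DecidableEq V] (G : SimpleGraph V) : ℝ :=
  sSup (spectrum ℝ (signlessLap G))

/-- The number of edges (size) of a graph. -/
noncomputable def numEdges {V : Type*} (G : SimpleGraph V) : ℕ :=
  Nat.card G.edgeSet

/-- The degree of a vertex. -/
noncomputable def deg {V : Type*} (G : SimpleGraph V) (v : V) : ℕ :=
  Nat.card (G.neighborSet v)

/-- A graph is `2` leaves-free if it has at most one vertex of degree one. -/
def TwoLeavesFree {V : Type*} (G : SimpleGraph V) : Prop :=
  ∀ u v : V, deg G u = 1 → deg G v = 1 → u = v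

/-- The maximum degree `Δ(G)`. -/
noncomputable def maxDeg {V : Type*} [Fintype V] (G : SimpleGraph V) : ℕ :=
  letI := Classical.decEq V
  letI := Classical.decRel G.Adj
  G.maxDegree

/-- `k` disjoint copies of `P₂`, i.e. a perfect matching on `2k` vertices. -/
def matching (k : ℕ) : SimpleGraph (Fin k × Fin 2) :=
  SimpleGraph.fromRel (fun a b => a.1 = b.1)

/-- The star graph `Sₙ` on `n` vertices (`K_{1,n-1}` with center `0`). -/
def starGraph (n : ℕ) : SimpleGraph (Fin n) :=
  SimpleGraph.fromRel (fun a _ => (a : ℕ) = 0)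

/-- Disjoint union of two graphs. -/
def dUnion {α β : Type*} (G : SimpleGraph α) (H : SimpleGraph β) : SimpleGraph (α ⊕ β) :=
  SimpleGraph.fromRel (fun a b =>
    (∃ x y, a = Sum.inl x ∧ b = Sum.inl y ∧ G.Adj x y) ∨
    (∃ x y, a = Sum.inr x ∧ b = Sum.inr y ∧ H.Adj x y))

/-- The join `K₁ ∨ H` : a new vertex (`none`) adjacent to every vertex of `H`. -/
def cone {α : Type*} (H : SimpleGraph α) : SimpleGraph (Option α) :=
  SimpleGraph.fromRel (fun a b =>
    a = none ∨ ∃ x y, a = some x ∧ b = some y ∧ H.Adj x y)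

open Classical in
/-- The signless Laplacian as an operator on functions. -/
noncomputable def signlessOp {V : Type*} [Fintype V] (G : SimpleGraph V) (x : V → ℝ) (v : V) : ℝ :=
  ∑ u, if G.Adj v u then x v + x u else 0

theorem signlessLap_mulVec {V : Type*} [Fintype V] [DecidableEq V] (G : SimpleGraph V)
    (x : V → ℝ) : (signlessLap G).mulVec x = signlessOp G x := by
  classical
  ext v
  simp only [signlessLap, Matrix.add_mulVec, Pi.add_apply, SimpleGraph.degMatrix_mulVec_apply,
    SimpleGraph.adjMatrix_mulVec_apply, signlessOp]
  rw [← Finset.sum_filter, Finset.sum_add_distrib, Finset.sum_const, nsmul_eq_mul,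
    ← SimpleGraph.neighborFinset_eq_filter, SimpleGraph.card_neighborFinset_eq_degree]

theorem mem_spectrum_signlessLap {V : Type*} [Fintype V] [DecidableEq V] (G : SimpleGraph V)
    (q : ℝ) :
    q ∈ spectrum ℝ (signlessLap G) ↔ ∃ x : V → ℝ, x ≠ 0 ∧ ∀ v, signlessOp G x v = q * x v := by
  rw [← Matrix.spectrum_toLin', ← Module.End.hasEigenvalue_iff_mem_spectrum]
  constructor
  · intro h
    obtain ⟨x, hx⟩ := h.exists_hasEigenvector
    refine ⟨x, hx.2, fun v => ?_⟩
    have := hx.apply_eq_smul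
    rw [Matrix.toLin'_apply, signlessLap_mulVec] at this
    simpa using congrFun this v
  · rintro ⟨x, hx, h⟩
    refine Module.End.hasEigenvalue_of_hasEigenvector (x := x)
      ⟨Module.End.mem_eigenspace_iff.2 ?_, hx⟩
    rw [Matrix.toLin'_apply, signlessLap_mulVec]
    ext v
    simpa using h v

theorem signlessOp_comp_iso {V W : Type*} [Fintype V] [Fintype W] {G : SimpleGraph V}
    {H : SimpleGraph W} (e : G ≃g H) (x : W → ℝ) (v : V) :
    signlessOp G (x ∘ e) v = signlessOp H x (e v) := by
  classical
  unfold signlessOp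
  rw [← Equiv.sum_comp e.toEquiv]
  exact Finset.sum_congr rfl fun u _ => if_congr e.map_adj_iff.symm rfl rfl

theorem spectrum_signlessLap_subset_of_iso {V W : Type*} [Fintype V] [DecidableEq V] [Fintype W]
    [DecidableEq W] {G : SimpleGraph V} {H : SimpleGraph W} (e : G ≃g H) :
    spectrum ℝ (signlessLap H) ⊆ spectrum ℝ (signlessLap G) := by
  intro q hq
  rw [mem_spectrum_signlessLap] at hq ⊢
  obtain ⟨x, hx, h⟩ := hq
  refine ⟨x ∘ e, fun h0 => hx ?_, fun v => ?_⟩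
  · ext v
    simpa using congrFun h0 (e.symm v)
  · rw [signlessOp_comp_iso]
    exact h _

theorem qIndex_congr {V W : Type*} [Fintype V] [DecidableEq V] [Fintype W] [DecidableEq W]
    {G : SimpleGraph V} {H : SimpleGraph W} (e : G ≃g H) : qIndex G = qIndex H :=
  congrArg sSup ((spectrum_signlessLap_subset_of_iso e.symm).antisymm
    (spectrum_signlessLap_subset_of_iso e))

theorem sum_mul_signlessOp_comm {V : Type*} [Fintype V] (G : SimpleGraph V) (x y : V → ℝ) :
    ∑ v, y v * signlessOp G x v = ∑ v, x v * signlessOp G y v := by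
  classical
  have h : ∀ x y : V → ℝ, ∑ v, y v * signlessOp G x v =
      (∑ v, ∑ u, if G.Adj v u then y v * x v else 0) +
        ∑ v, ∑ u, if G.Adj v u then y v * x u else 0 := by
    intro x y
    simp only [signlessOp, Finset.mul_sum, ← Finset.sum_add_distrib]
    refine Finset.sum_congr rfl fun v _ => Finset.sum_congr rfl fun u _ => ?_
    split_ifs <;> ring
  rw [h, h, Finset.sum_comm (f := fun v u => if G.Adj v u then y v * x u else 0)]
  simp only [mul_comm, G.adj_comm]

theorem mul_abs_le_signlessOp_abs {V : Type*} [Fintype V] {G : SimpleGraph V} {x : V → ℝ} {q : ℝ}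
    (hx : ∀ v, signlessOp G x v = q * x v) (v : V) :
    q * |x v| ≤ signlessOp G (fun u => |x u|) v := by
  classical
  calc q * |x v| ≤ |q| * |x v| := mul_le_mul_of_nonneg_right (le_abs_self q) (abs_nonneg _)
    _ = |signlessOp G x v| := by rw [hx, abs_mul]
    _ ≤ _ := by
      unfold signlessOp
      refine (Finset.abs_sum_le_sum_abs _ _).trans (Finset.sum_le_sum fun u _ => ?_)
      split_ifs
      · exact abs_add_le _ _
      · simp

/-- A positive supersolution bounds every eigenvalue. -/
theorem eigenvalue_le_of_supersolution {V : Type*} [Fintype V] {G : SimpleGraph V} {x y : V → ℝ}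
    {μ q : ℝ} (hx0 : x ≠ 0) (hx : ∀ v, signlessOp G x v = μ * x v) (hy0 : ∀ v, 0 < y v)
    (hy : ∀ v, signlessOp G y v ≤ q * y v) : μ ≤ q := by
  obtain ⟨w, hw⟩ := Function.ne_iff.1 hx0
  have hpos : 0 < ∑ v, y v * |x v| :=
    Finset.sum_pos' (fun v _ => mul_nonneg (hy0 v).le (abs_nonneg _))
      ⟨w, Finset.mem_univ _, mul_pos (hy0 w) (abs_pos.2 hw)⟩
  have h1 : μ * ∑ v, y v * |x v| ≤ ∑ v, y v * signlessOp G (fun u => |x u|) v := by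
    rw [Finset.mul_sum]
    refine Finset.sum_le_sum fun v _ => ?_
    nlinarith [mul_le_mul_of_nonneg_left (mul_abs_le_signlessOp_abs hx v) (hy0 v).le]
  have h2 : ∑ v, |x v| * signlessOp G y v ≤ q * ∑ v, y v * |x v| := by
    rw [Finset.mul_sum]
    refine Finset.sum_le_sum fun v _ => ?_
    nlinarith [mul_le_mul_of_nonneg_left (hy v) (abs_nonneg (x v))]
  rw [sum_mul_signlessOp_comm] at h1
  exact le_of_mul_le_mul_right (h1.trans h2) hpos

theorem supersolution_eq {V : Type*} [Fintype V] {G : SimpleGraph V} {x y : V → ℝ}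
    {q : ℝ} (hx : ∀ v, signlessOp G x v = q * x v) (hy0 : ∀ v, 0 < y v)
    (hy : ∀ v, signlessOp G y v ≤ q * y v) (v : V) (hv : x v ≠ 0) :
    signlessOp G y v = q * y v := by
  have h1 : q * ∑ v, y v * |x v| ≤ ∑ v, y v * signlessOp G (fun u => |x u|) v := by
    rw [Finset.mul_sum]
    refine Finset.sum_le_sum fun v _ => ?_
    nlinarith [mul_le_mul_of_nonneg_left (mul_abs_le_signlessOp_abs hx v) (hy0 v).le]
  have h2 : ∀ v ∈ Finset.univ, |x v| * signlessOp G y v ≤ q * (y v * |x v|) := fun v _ => by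
    nlinarith [mul_le_mul_of_nonneg_left (hy v) (abs_nonneg (x v))]
  rw [sum_mul_signlessOp_comm, Finset.mul_sum] at h1
  have h3 := (Finset.sum_eq_sum_iff_of_le h2).1 ((Finset.sum_le_sum h2).antisymm h1) v
    (Finset.mem_univ v)
  have : |x v| * (signlessOp G y v - q * y v) = 0 := by linarith
  rcases mul_eq_zero.1 this with h | h
  · exact absurd (abs_eq_zero.1 h) hv
  · linarith

theorem supersolution_abs_eq {V : Type*} [Fintype V] {G : SimpleGraph V} {x y : V → ℝ}
    {q : ℝ} (hx : ∀ v, signlessOp G x v = q * x v) (hy0 : ∀ v, 0 < y v)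
    (hy : ∀ v, signlessOp G y v ≤ q * y v) (v : V) :
    signlessOp G (fun u => |x u|) v = q * |x v| := by
  have h1 : ∀ v ∈ Finset.univ, q * (y v * |x v|) ≤ y v * signlessOp G (fun u => |x u|) v :=
    fun v _ => by
      nlinarith [mul_le_mul_of_nonneg_left (mul_abs_le_signlessOp_abs hx v) (hy0 v).le]
  have h2 : ∑ v, |x v| * signlessOp G y v ≤ ∑ v, q * (y v * |x v|) := by
    refine Finset.sum_le_sum fun v _ => ?_
    nlinarith [mul_le_mul_of_nonneg_left (hy v) (abs_nonneg (x v))]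
  rw [← sum_mul_signlessOp_comm] at h2
  have h3 := (Finset.sum_eq_sum_iff_of_le h1).1 ((Finset.sum_le_sum h1).antisymm h2) v
    (Finset.mem_univ v)
  exact mul_left_cancel₀ (hy0 v).ne' (by linarith)

theorem qIndex_le_of_supersolution {V : Type*} [Fintype V] [DecidableEq V] {G : SimpleGraph V}
    {y : V → ℝ} {q : ℝ} (hq : 0 ≤ q) (hy0 : ∀ v, 0 < y v)
    (hy : ∀ v, signlessOp G y v ≤ q * y v) : qIndex G ≤ q := by
  refine Real.sSup_le (fun μ hμ => ?_) hq
  obtain ⟨x, hx0, hx⟩ := (mem_spectrum_signlessLap G μ).1 hμ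
  exact eigenvalue_le_of_supersolution hx0 hx hy0 hy

theorem qIndex_eq_of_solution {V : Type*} [Fintype V] [DecidableEq V] [Nonempty V]
    {G : SimpleGraph V} {y : V → ℝ} {q : ℝ} (hq : 0 ≤ q) (hy0 : ∀ v, 0 < y v)
    (hy : ∀ v, signlessOp G y v = q * y v) : qIndex G = q := by
  refine (qIndex_le_of_supersolution hq hy0 fun v => (hy v).le).antisymm ?_
  refine le_csSup (Matrix.finite_spectrum _).bddAbove ((mem_spectrum_signlessLap G q).2
    ⟨y, fun h => ?_, hy⟩)
  exact (hy0 (Classical.arbitrary V)).ne' (congrFun h _)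

theorem exists_eigenvector_of_qIndex_eq {V : Type*} [Fintype V] [DecidableEq V]
    {G : SimpleGraph V} {q : ℝ} (hq : 0 < q) (h : qIndex G = q) :
    ∃ x : V → ℝ, x ≠ 0 ∧ ∀ v, signlessOp G x v = q * x v := by
  rw [← mem_spectrum_signlessLap, ← h]
  refine Set.Nonempty.csSup_mem ?_ (Matrix.finite_spectrum _)
  by_contra h0
  rw [Set.not_nonempty_iff_eq_empty] at h0
  rw [qIndex, h0, Real.sSup_empty] at h
  exact hq.ne h

theorem cone_adj_none_some {α : Type*} (H : SimpleGraph α) (v : α) :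
    (cone H).Adj none (some v) := by
  simp [cone]

theorem cone_adj_some_none {α : Type*} (H : SimpleGraph α) (v : α) :
    (cone H).Adj (some v) none := by
  simp [cone]

theorem cone_adj_some_some {α : Type*} (H : SimpleGraph α) (v w : α) :
    (cone H).Adj (some v) (some w) ↔ H.Adj v w := by
  simp only [cone, SimpleGraph.fromRel_adj, ne_eq, Option.some.injEq, reduceCtorEq, false_or]
  constructor
  · rintro ⟨-, ⟨x, y, rfl, rfl, h⟩ | ⟨x, y, rfl, rfl, h⟩⟩
    exacts [h, h.symm]
  · exact fun h => ⟨h.ne, Or.inl ⟨v, w, rfl, rfl, h⟩⟩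

/-- Isomorphic graphs have isomorphic cones. -/
def coneIso {α β : Type*} {G : SimpleGraph α} {H : SimpleGraph β} (e : G ≃g H) :
    cone G ≃g cone H where
  toEquiv := Equiv.optionCongr e.toEquiv
  map_rel_iff' := by
    rintro (_ | a) (_ | b) <;>
      simp [cone_adj_none_some, cone_adj_some_none, cone_adj_some_some, e.map_adj_iff]

theorem signlessOp_cone_none {α : Type*} [Fintype α] (H : SimpleGraph α) (x : Option α → ℝ) :
    signlessOp (cone H) x none = ∑ v, (x none + x (some v)) := by
  simp [signlessOp, Fintype.sum_option, cone_adj_none_some]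

theorem signlessOp_cone_some {α : Type*} [Fintype α] (H : SimpleGraph α) (x : Option α → ℝ)
    (v : α) : signlessOp (cone H) x (some v) =
      x (some v) + x none + signlessOp H (fun u => x (some u)) v := by
  classical
  simp only [signlessOp, Fintype.sum_option, cone_adj_some_none, if_true]
  congr 1
  exact Finset.sum_congr rfl fun u _ => if_congr (cone_adj_some_some H v u) rfl rfl

theorem cone_eigenvector_ne_zero {α : Type*} [Fintype α] {H : SimpleGraph α}
    {x : Option α → ℝ} {q : ℝ} (hx0 : x ≠ 0)
    (hx : ∀ v, signlessOp (cone H) (fun u => |x u|) v = q * |x v|) (v : Option α) : x v ≠ 0 := by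
  have hnone : x none ≠ 0 := by
    intro h0
    have h1 := hx none
    rw [signlessOp_cone_none] at h1
    simp only [h0, abs_zero, zero_add, mul_zero] at h1
    rw [Finset.sum_eq_zero_iff_of_nonneg fun _ _ => abs_nonneg _] at h1
    refine hx0 (funext fun v => ?_)
    cases v with
    | none => exact h0
    | some v => exact abs_eq_zero.1 (h1 v (Finset.mem_univ v))
  cases v with
  | none => exact hnone
  | some v =>
    intro h0
    have h1 := hx (some v)
    rw [signlessOp_cone_some] at h1
    have h2 : 0 ≤ signlessOp H (fun u => |x (some u)|) v := by
      refine Finset.sum_nonneg fun u _ => ?_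
      split_ifs
      · positivity
      · rfl
    simp only [h0, abs_zero, mul_zero] at h1
    have := abs_pos.2 hnone
    linarith

open Classical in
theorem natCast_deg {V : Type*} [Fintype V] (G : SimpleGraph V) (v : V) :
    (deg G v : ℝ) = ∑ u, if G.Adj v u then 1 else 0 := by
  rw [Finset.sum_boole, deg, Nat.card_eq_fintype_card, SimpleGraph.card_neighborSet_eq_degree,
    ← SimpleGraph.card_neighborFinset_eq_degree, SimpleGraph.neighborFinset_eq_filter]

/-- The test vector on `G`, built from degrees and a vertex function `m`
which for a star forest records the size of the component of each vertex. -/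
noncomputable def degVector {V : Type*} (G : SimpleGraph V) (m : V → ℝ) (t : ℝ) (v : V) : ℝ :=
  1 / t + 2 / t * (deg G v / (t - m v))

/-- The extension of `degVector` to the cone by the value `1` at the apex. -/
noncomputable def coneVector {V : Type*} (G : SimpleGraph V) (m : V → ℝ) (t : ℝ) :
    Option V → ℝ :=
  fun o => o.elim 1 (degVector G m t)

open Classical in
theorem signlessOp_degVector {V : Type*} [Fintype V] {G : SimpleGraph V} {m : V → ℝ} {t : ℝ}
    (ht : 0 < t) (hm : ∀ v, m v < t) (hconst : ∀ u v, G.Adj u v → m u = m v) (v : V) :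
    signlessOp G (degVector G m t) v + (∑ u, if G.Adj v u then
      2 / t * ((m v - (deg G v + deg G u)) / (t - m v)) else 0) = t * degVector G m t v - 1 := by
  have h1 : t - m v ≠ 0 := (sub_pos.2 (hm v)).ne'
  have h2 : t * degVector G m t v - 1 = ∑ u, if G.Adj v u then 2 / (t - m v) else 0 := by
    have : ∀ u, (if G.Adj v u then 2 / (t - m v) else 0) =
        2 / (t - m v) * if G.Adj v u then 1 else 0 := fun u => by split_ifs <;> simp
    simp only [this]
    rw [← Finset.mul_sum, ← natCast_deg, degVector]
    field_simp
    ring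
  rw [h2, signlessOp, ← Finset.sum_add_distrib]
  refine Finset.sum_congr rfl fun u _ => ?_
  split_ifs with h
  · rw [degVector, degVector, ← hconst v u h]
    field_simp
    ring
  · simp

theorem coneVector_pos {V : Type*} {G : SimpleGraph V} {m : V → ℝ} {t : ℝ}
    (ht : 0 < t) (hm : ∀ v, m v < t) (o : Option V) : 0 < coneVector G m t o := by
  cases o with
  | none => exact one_pos
  | some v =>
    have := sub_pos.2 (hm v)
    change 0 < degVector G m t v
    unfold degVector
    positivity

theorem signlessOp_cone_coneVector_none {V : Type*} [Fintype V] (G : SimpleGraph V) (m : V → ℝ)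
    (t : ℝ) : signlessOp (cone G) (coneVector G m t) none =
      Fintype.card V + Fintype.card V / t + 2 / t * ∑ v, deg G v / (t - m v) := by
  rw [signlessOp_cone_none]
  simp only [coneVector, Option.elim, degVector, Finset.sum_add_distrib, ← Finset.mul_sum]
  simp
  ring

theorem signlessOp_cone_coneVector_some {V : Type*} [Fintype V] (G : SimpleGraph V) (m : V → ℝ)
    (t : ℝ) (v : V) : signlessOp (cone G) (coneVector G m t) (some v) =
      degVector G m t v + 1 + signlessOp G (degVector G m t) v :=
  signlessOp_cone_some G _ v

/-- The sum of `deg v / (t - m v)` over the vertices `v` of `S_{k+2} ∪ pP₂`, where `m v` is the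
order of the component of `v`. -/
noncomputable def starForestSum (k p : ℕ) (t : ℝ) : ℝ :=
  2 * (k + 1) / (t - (k + 2)) + 2 * p / (t - 2)

/-- The characteristic equation of `K₁ ∨ (S_{k+2} ∪ pP₂)` has a root `t + 1` with `t > k + 2`. -/
theorem exists_root (k p : ℕ) : ∃ t : ℝ, (k : ℝ) + 2 < t ∧
    ((k + 2 + 2 * p : ℕ) : ℝ) + ((k + 2 + 2 * p : ℕ) : ℝ) / t + 2 / t * starForestSum k p t =
      t + 1 := by
  set f : ℝ → ℝ := fun t => t + 1 - (((k + 2 + 2 * p : ℕ) : ℝ) +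
    ((k + 2 + 2 * p : ℕ) : ℝ) / t + 2 / t * starForestSum k p t) with hf
  have hk : (0 : ℝ) ≤ k := k.cast_nonneg
  have hp : (0 : ℝ) ≤ p := p.cast_nonneg
  have hle : (k : ℝ) + 3 ≤ k + 2 * p + 6 := by linarith
  have hcont : ContinuousOn f (Set.Icc ((k : ℝ) + 3) (k + 2 * p + 6)) := by
    simp only [hf, starForestSum]
    refine ContinuousOn.sub (by fun_prop) (ContinuousOn.add (ContinuousOn.add (by fun_prop)
      (ContinuousOn.div (by fun_prop) (by fun_prop) ?_)) (ContinuousOn.mul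
      (ContinuousOn.div (by fun_prop) (by fun_prop) ?_) (ContinuousOn.add
      (ContinuousOn.div (by fun_prop) (by fun_prop) ?_)
      (ContinuousOn.div (by fun_prop) (by fun_prop) ?_))))
    all_goals
      intro x hx
      have := hx.1
      apply ne_of_gt
      linarith
  have h0 : f (k + 3) ≤ 0 := by
    simp only [hf, starForestSum]
    push_cast
    have e1 : (k : ℝ) + 3 - (k + 2) = 1 := by ring
    have e2 : (0 : ℝ) ≤ 2 * p / (k + 3 - 2) := div_nonneg (by linarith) (by linarith)
    have e3 : (0 : ℝ) ≤ 2 / (k + 3) * (2 * p / (k + 3 - 2)) := by positivity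
    have e4 : (0 : ℝ) ≤ 2 * p / (k + 3) := by positivity
    have e5 : 2 ≤ ((k : ℝ) + 2) / (k + 3) + 2 / (k + 3) * (2 * (k + 1) / 1) := by
      rw [div_one, div_mul_eq_mul_div, ← add_div, le_div_iff₀ (by linarith)]
      linarith
    rw [e1, add_div _ _ ((k : ℝ) + 3), mul_add]
    linarith
  have h1 : 0 ≤ f (k + 2 * p + 6) := by
    simp only [hf, starForestSum]
    push_cast
    have e0 : (0 : ℝ) < k + 2 * p + 6 := by linarith
    have e1 : ((k : ℝ) + 2 + 2 * p) / (k + 2 * p + 6) ≤ 1 := by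
      rw [div_le_one e0]; linarith
    have e2 : 2 * ((k : ℝ) + 1) / (k + 2 * p + 6 - (k + 2)) ≤ (k + 1) / 2 := by
      rw [div_le_div_iff₀ (by linarith) (by norm_num)]
      nlinarith [mul_nonneg hk hp]
    have e3 : 2 * (p : ℝ) / (k + 2 * p + 6 - 2) ≤ 1 := by
      rw [div_le_one (by linarith)]
      linarith
    have e4 : 2 / ((k : ℝ) + 2 * p + 6) * (2 * (k + 1) / (k + 2 * p + 6 - (k + 2)) +
        2 * p / (k + 2 * p + 6 - 2)) ≤ 2 / (k + 2 * p + 6) * ((k + 1) / 2 + 1) := by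
      gcongr
    have e5 : 2 / ((k : ℝ) + 2 * p + 6) * ((k + 1) / 2 + 1) ≤ 1 := by
      rw [div_mul_eq_mul_div, div_le_one e0]
      linarith
    linarith
  obtain ⟨t, ht, h⟩ := intermediate_value_Icc hle hcont ⟨h0, h1⟩
  exact ⟨t, by linarith [ht.1], by simp only [hf] at h; linarith⟩

theorem dUnion_adj_inl {α β : Type*} {G : SimpleGraph α} {H : SimpleGraph β} {a b : α} :
    (dUnion G H).Adj (Sum.inl a) (Sum.inl b) ↔ G.Adj a b := by
  simp only [dUnion, SimpleGraph.fromRel_adj, ne_eq, Sum.inl.injEq, reduceCtorEq, false_and,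
    exists_false, or_false, exists_and_left, and_false]
  constructor
  · rintro ⟨-, ⟨x, rfl, y, rfl, h⟩ | ⟨x, rfl, y, rfl, h⟩⟩
    exacts [h, h.symm]
  · exact fun h => ⟨h.ne, Or.inl ⟨a, rfl, b, rfl, h⟩⟩

theorem dUnion_adj_inr {α β : Type*} {G : SimpleGraph α} {H : SimpleGraph β} {a b : β} :
    (dUnion G H).Adj (Sum.inr a) (Sum.inr b) ↔ H.Adj a b := by
  simp only [dUnion, SimpleGraph.fromRel_adj, ne_eq, Sum.inr.injEq, reduceCtorEq, false_and,
    exists_false, false_or, exists_and_left, and_false]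
  constructor
  · rintro ⟨-, ⟨x, rfl, y, rfl, h⟩ | ⟨x, rfl, y, rfl, h⟩⟩
    exacts [h, h.symm]
  · exact fun h => ⟨h.ne, Or.inl ⟨a, rfl, b, rfl, h⟩⟩

theorem not_dUnion_adj_inl_inr {α β : Type*} {G : SimpleGraph α} {H : SimpleGraph β} {a : α}
    {b : β} : ¬ (dUnion G H).Adj (Sum.inl a) (Sum.inr b) := by
  simp [dUnion]

theorem not_dUnion_adj_inr_inl {α β : Type*} {G : SimpleGraph α} {H : SimpleGraph β} {a : α}
    {b : β} : ¬ (dUnion G H).Adj (Sum.inr b) (Sum.inl a) := by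
  simp [dUnion]

theorem starGraph_adj {n : ℕ} {a b : Fin n} :
    (starGraph n).Adj a b ↔ a ≠ b ∧ ((a : ℕ) = 0 ∨ (b : ℕ) = 0) := by
  simp [starGraph]

theorem matching_adj {n : ℕ} {a b : Fin n × Fin 2} :
    (matching n).Adj a b ↔ a ≠ b ∧ a.1 = b.1 := by
  simp [matching, eq_comm]

theorem deg_starForest_inl (k p : ℕ) (a : Fin (k + 2)) :
    (deg (dUnion (starGraph (k + 2)) (matching p)) (Sum.inl a) : ℝ) =
      if a = 0 then (k : ℝ) + 1 else 1 := by
  classical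
  rw [natCast_deg]
  simp only [Fintype.sum_sum_type, dUnion_adj_inl, not_dUnion_adj_inl_inr, if_false,
    Finset.sum_const_zero, add_zero, starGraph_adj]
  rw [Fin.sum_univ_succ]
  cases a using Fin.cases with
  | zero => simp [(Fin.succ_ne_zero _).symm]
  | succ j => simp [Fin.succ_ne_zero]

theorem deg_starForest_inr (k p : ℕ) (a : Fin p × Fin 2) :
    (deg (dUnion (starGraph (k + 2)) (matching p)) (Sum.inr a) : ℝ) = 1 := by
  classical
  rw [natCast_deg]
  simp only [Fintype.sum_sum_type, dUnion_adj_inr, not_dUnion_adj_inr_inl, if_false,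
    Finset.sum_const_zero, zero_add, matching_adj]
  obtain ⟨i, j⟩ := a
  rw [Finset.sum_eq_single (i, 1 - j)]
  · fin_cases j <;> simp
  · rintro ⟨i', j'⟩ - h
    rw [if_neg]
    rintro ⟨h1, h2⟩
    simp only at h2
    subst h2
    fin_cases j <;> fin_cases j' <;> simp at h h1
  · simp

theorem qIndex_starForest {k p : ℕ} {t : ℝ} (ht : (k : ℝ) + 2 < t)
    (hroot : ((k + 2 + 2 * p : ℕ) : ℝ) + ((k + 2 + 2 * p : ℕ) : ℝ) / t +
      2 / t * starForestSum k p t = t + 1) :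
    qIndex (cone (dUnion (starGraph (k + 2)) (matching p))) = t + 1 := by
  have hk : (0 : ℝ) ≤ k := k.cast_nonneg
  have ht0 : 0 < t := by linarith
  set m : Fin (k + 2) ⊕ (Fin p × Fin 2) → ℝ := Sum.elim (fun _ => k + 2) (fun _ => 2) with hm
  have hmt : ∀ v, m v < t := by
    rintro (a | a)
    · exact ht
    · change (2 : ℝ) < t
      linarith
  refine qIndex_eq_of_solution
    (y := coneVector (dUnion (starGraph (k + 2)) (matching p)) m t) (by linarith)
    (coneVector_pos ht0 hmt) ?_
  rintro (_ | v)
  · rw [signlessOp_cone_coneVector_none]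
    simp only [coneVector, Option.elim, mul_one]
    rw [← hroot]
    have h1 : Fintype.card (Fin (k + 2) ⊕ (Fin p × Fin 2)) = k + 2 + 2 * p := by simp [mul_comm]
    rw [h1]
    congr 2
    simp only [Fintype.sum_sum_type, deg_starForest_inl, deg_starForest_inr, hm, Sum.elim_inl,
      Sum.elim_inr, starForestSum]
    rw [Fin.sum_univ_succ]
    simp [Fin.succ_ne_zero]
    ring
  · rw [signlessOp_cone_coneVector_some]
    have h := signlessOp_degVector (G := dUnion (starGraph (k + 2)) (matching p)) ht0 hmt ?_ v
    · rw [Finset.sum_eq_zero, add_zero] at h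
      · rw [h]
        simp only [coneVector, Option.elim]
        ring
      · intro u _
        split_ifs with huv
        · refine mul_eq_zero_of_right _ (div_eq_zero_iff.2 (Or.inl ?_))
          rcases u with u | u <;> rcases v with v | v
          · rw [dUnion_adj_inl, starGraph_adj] at huv
            simp only [hm, Sum.elim_inl, deg_starForest_inl, Fin.ext_iff, Fin.val_zero]
            have := fun h => huv.1 (Fin.ext h)
            split_ifs <;> first | omega | ring
          · exact absurd huv not_dUnion_adj_inr_inl
          · exact absurd huv not_dUnion_adj_inl_inr
          · simp only [hm, Sum.elim_inr, deg_starForest_inr]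
            norm_num
        · rfl
    · rintro (u | u) (v | v) huv
      · rfl
      · exact absurd huv not_dUnion_adj_inl_inr
      · exact absurd huv not_dUnion_adj_inr_inl
      · rfl

theorem deg_toSimpleGraph {V : Type*} (F : SimpleGraph V) (C : F.ConnectedComponent) (v : C) :
    deg C.toSimpleGraph v = deg F v := by
  refine Nat.card_congr
    { toFun := fun u => ⟨u.1.1, u.2⟩
      invFun := fun u => ⟨⟨u.1, C.mem_supp_of_adj_mem_supp v.2 u.2⟩, u.2⟩
      left_inv := fun u => rfl
      right_inv := fun u => rfl }

theorem deg_eq_degree {V : Type*} [Fintype V] (G : SimpleGraph V) [DecidableRel G.Adj] (v : V) :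
    deg G v = G.degree v := by
  rw [deg, Nat.card_eq_fintype_card, SimpleGraph.card_neighborSet_eq_degree]

theorem sum_deg_eq_twice_numEdges {V : Type*} [Fintype V] (G : SimpleGraph V) :
    ∑ v, deg G v = 2 * numEdges G := by
  classical
  simp only [deg_eq_degree, G.sum_degrees_eq_twice_card_edges, numEdges,
    Nat.card_eq_fintype_card, SimpleGraph.edgeFinset_card]

/-- The order of a connected component. -/
noncomputable def compOrder {V : Type*} (F : SimpleGraph V) (C : F.ConnectedComponent) : ℕ :=
  Nat.card {v // F.connectedComponentMk v = C}

theorem sum_deg_component {V : Type*} [Fintype V] {F : SimpleGraph V} (hF : F.IsAcyclic)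
    [DecidableEq F.ConnectedComponent]
    (C : F.ConnectedComponent) :
    ∑ v with F.connectedComponentMk v = C, deg F v + 2 = 2 * compOrder F C := by
  classical
  have : Fintype C := Fintype.ofFinite C
  have h1 := (hF.isTree_connectedComponent C).card_edgeFinset
  have h2 := sum_deg_eq_twice_numEdges C.toSimpleGraph
  rw [numEdges, Nat.card_eq_fintype_card, ← SimpleGraph.edgeFinset_card] at h2
  have h3 : compOrder F C = Fintype.card C := Nat.card_eq_fintype_card (α := C)
  have h4 : ∑ v with F.connectedComponentMk v = C, deg F v = ∑ v, deg C.toSimpleGraph v := by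
    rw [Finset.sum_subtype (p := fun v => v ∈ C) (F := this) _ (fun v => by
      simp only [Finset.mem_filter, Finset.mem_univ, true_and]
      exact Iff.rfl)]
    exact Finset.sum_congr rfl fun v _ => (deg_toSimpleGraph F C v).symm
  rw [h4, h3, h2, ← h1]
  ring

theorem card_filter_component {V : Type*} [Fintype V] (F : SimpleGraph V)
    [DecidableEq F.ConnectedComponent]
    (C : F.ConnectedComponent) :
    Finset.card {v | F.connectedComponentMk v = C} = compOrder F C := by
  rw [compOrder, Nat.card_eq_fintype_card, Fintype.card_subtype]

theorem sum_compOrder {V : Type*} [Fintype V] (F : SimpleGraph V) [Fintype F.ConnectedComponent] :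
    ∑ C, compOrder F C = Fintype.card V := by
  have : DecidableEq F.ConnectedComponent := Classical.decEq _
  simp only [← card_filter_component]
  rw [← Finset.card_univ (α := V)]
  exact (Finset.card_eq_sum_card_fiberwise fun _ _ => Finset.mem_univ _).symm

theorem sum_deg_mul_component {V : Type*} [Fintype V] {F : SimpleGraph V} (hF : F.IsAcyclic)
    [Fintype F.ConnectedComponent] (w : F.ConnectedComponent → ℝ) :
    ∑ v, deg F v * w (F.connectedComponentMk v) = ∑ C, (2 * compOrder F C - 2) * w C := by
  have : DecidableEq F.ConnectedComponent := Classical.decEq _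
  rw [← Finset.sum_fiberwise (s := Finset.univ) (g := F.connectedComponentMk)]
  refine Finset.sum_congr rfl fun C _ => ?_
  have h : ((∑ v with F.connectedComponentMk v = C, deg F v + 2 : ℕ) : ℝ) =
      (2 * compOrder F C : ℕ) := by rw [sum_deg_component hF]
  push_cast at h
  rw [← h, add_sub_cancel_right, Finset.sum_mul]
  exact Finset.sum_congr rfl fun v hv => by rw [(Finset.mem_filter.1 hv).2]

/-- In a forest, adjacent vertices have disjoint neighborhoods inside their component. -/
theorem deg_add_deg_le {V : Type*} [Fintype V] {F : SimpleGraph V} (hF : F.IsAcyclic) {u v : V}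
    (h : F.Adj v u) : deg F v + deg F u ≤ compOrder F (F.connectedComponentMk v) := by
  classical
  have : DecidableEq F.ConnectedComponent := Classical.decEq _
  rw [← card_filter_component, deg_eq_degree, deg_eq_degree,
    ← SimpleGraph.card_neighborFinset_eq_degree, ← SimpleGraph.card_neighborFinset_eq_degree,
    ← Finset.card_union_of_disjoint]
  · refine Finset.card_le_card fun w hw => ?_
    simp only [Finset.mem_union, SimpleGraph.mem_neighborFinset, Finset.mem_filter,
      Finset.mem_univ, true_and] at hw ⊢
    rw [SimpleGraph.ConnectedComponent.eq]
    rcases hw with hw | hw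
    · exact hw.symm.reachable
    · exact hw.symm.reachable.trans h.symm.reachable
  · rw [Finset.disjoint_left]
    intro w hv hu
    rw [SimpleGraph.mem_neighborFinset] at hv hu
    have := hF.cliqueFree le_rfl {v, u, w}
    rw [SimpleGraph.is3Clique_triple_iff] at this
    exact this ⟨h, hv, hu⟩

theorem two_le_compOrder {V : Type*} [Fintype V] {F : SimpleGraph V} (hF : F.IsAcyclic)
    (hmin : ∀ v, 1 ≤ deg F v) (C : F.ConnectedComponent) : 2 ≤ compOrder F C := by
  obtain ⟨v, rfl⟩ := C.exists_rep
  obtain ⟨⟨u, hu⟩⟩ : Nonempty (F.neighborSet v) := (Nat.card_pos_iff.1 (hmin v)).1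
  have h1 := deg_add_deg_le hF (u := u) (v := v) hu
  have := hmin v
  have := hmin u
  change 2 ≤ compOrder F (F.connectedComponentMk v)
  omega

theorem card_eq_numEdges_add {V : Type*} [Fintype V] {F : SimpleGraph V} (hF : F.IsAcyclic) :
    Fintype.card V = numEdges F + Nat.card F.ConnectedComponent := by
  classical
  have : Fintype F.ConnectedComponent := Fintype.ofFinite _
  have : DecidableEq F.ConnectedComponent := Classical.decEq _
  have h1 : ∑ C, (∑ v with F.connectedComponentMk v = C, deg F v + 2) =
      ∑ C, 2 * compOrder F C := Finset.sum_congr rfl fun C _ => sum_deg_component hF C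
  rw [Finset.sum_add_distrib, Finset.sum_fiberwise, sum_deg_eq_twice_numEdges,
    ← Finset.mul_sum, sum_compOrder, Finset.sum_const, Finset.card_univ, smul_eq_mul,
    ← Nat.card_eq_fintype_card (α := F.ConnectedComponent)] at h1
  omega

theorem exists_injOn_fin {α : Type*} [Finite α] {P : α → Prop} {n : ℕ} {z : α} (hz : P z)
    (h : Nat.card {a // P a} = n + 1) :
    ∃ g : α → Fin (n + 1), g z = 0 ∧ ∀ a b, P a → P b → g a = g b → a = b := by
  classical
  have e : {a // P a} ≃ Fin (n + 1) := Finite.equivFinOfCardEq h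
  refine ⟨fun a => if ha : P a then Equiv.swap (e ⟨z, hz⟩) 0 (e ⟨a, ha⟩) else 0, ?_, ?_⟩
  · simp [hz]
  · intro a b ha hb hab
    simpa [ha, hb] using hab

/-- A graph whose vertices are partitioned into one star and single edges is a star forest. -/
theorem nonempty_iso_starForest {V ι : Type*} [Fintype V] [Finite ι] {F : SimpleGraph V}
    {k p : ℕ} (κ : V → ι) (z : V) (hκ : Function.Surjective κ)
    (hcard : Fintype.card V = k + 2 + 2 * p) (hι : Nat.card ι = p + 1)
    (h0 : Nat.card {v // κ v = κ z} = k + 2) (h1 : ∀ c ≠ κ z, Nat.card {v // κ v = c} = 2)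
    (hadj : ∀ v w, F.Adj v w ↔ v ≠ w ∧ κ v = κ w ∧ (κ v = κ z → v = z ∨ w = z)) :
    Nonempty (F ≃g dUnion (starGraph (k + 2)) (matching p)) := by
  classical
  obtain ⟨g₀, hg₀z, hg₀⟩ := exists_injOn_fin (P := fun v => κ v = κ z) (n := k + 1) rfl h0
  have hex : ∀ c, ∃ g : V → Fin 2, c ≠ κ z → ∀ a b, κ a = c → κ b = c → g a = g b → a = b := by
    intro c
    by_cases hc : c = κ z
    · exact ⟨fun _ => 0, fun h => absurd hc h⟩
    · obtain ⟨v, hv⟩ := hκ c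
      obtain ⟨g, -, hg⟩ := exists_injOn_fin (P := fun v => κ v = c) (n := 1) hv (h1 c hc)
      exact ⟨g, fun _ => hg⟩
  choose g hg using hex
  have hcι : Nat.card {c // c ≠ κ z} = p := by
    have : Fintype ι := Fintype.ofFinite ι
    rw [Nat.card_eq_fintype_card] at hι ⊢
    rw [Fintype.card_subtype_compl, hι]
    simp
  have e : {c // c ≠ κ z} ≃ Fin p := Finite.equivFinOfCardEq hcι
  set f : V → Fin (k + 2) ⊕ (Fin p × Fin 2) := fun v =>
    if h : κ v = κ z then Sum.inl (g₀ v) else Sum.inr (e ⟨κ v, h⟩, g (κ v) v) with hf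
  have f0 : ∀ v, κ v = κ z → f v = Sum.inl (g₀ v) := fun v h => by simp [hf, h]
  have f1 : ∀ v (h : κ v ≠ κ z), f v = Sum.inr (e ⟨κ v, h⟩, g (κ v) v) := fun v h => by
    simp [hf, h]
  have hinj : Function.Injective f := by
    intro v w hvw
    by_cases hv : κ v = κ z <;> by_cases hw : κ w = κ z
    · rw [f0 v hv, f0 w hw, Sum.inl.injEq] at hvw
      exact hg₀ v w hv hw hvw
    · rw [f0 v hv, f1 w hw] at hvw
      cases hvw
    · rw [f1 v hv, f0 w hw] at hvw
      cases hvw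
    · rw [f1 v hv, f1 w hw, Sum.inr.injEq, Prod.mk.injEq, e.injective.eq_iff,
        Subtype.mk.injEq] at hvw
      refine hg _ hv v w rfl hvw.1.symm ?_
      rw [hvw.2, hvw.1]
  have hbij : Function.Bijective f := by
    rw [Fintype.bijective_iff_injective_and_card]
    exact ⟨hinj, by simp [hcard, mul_comm]⟩
  refine ⟨⟨Equiv.ofBijective f hbij, fun {v w} => ?_⟩⟩
  rw [Equiv.ofBijective_apply, Equiv.ofBijective_apply, hadj]
  by_cases hv : κ v = κ z <;> by_cases hw : κ w = κ z
  · have hz0 : ∀ a, κ a = κ z → ((g₀ a : ℕ) = 0 ↔ a = z) := fun a ha => by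
      constructor
      · intro h
        exact hg₀ a z ha rfl (by rw [hg₀z]; exact Fin.ext h)
      · rintro rfl
        rw [hg₀z]
        rfl
    have : g₀ v = g₀ w ↔ v = w := ⟨hg₀ v w hv hw, fun h => by rw [h]⟩
    rw [f0 v hv, f0 w hw, dUnion_adj_inl, starGraph_adj, hz0 v hv, hz0 w hw, ne_eq, this]
    simp [hv, hw]
  · rw [f0 v hv, f1 w hw]
    simp only [not_dUnion_adj_inl_inr, false_iff]
    exact fun h => hw (h.2.1.symm.trans hv)
  · rw [f1 v hv, f0 w hw]
    simp only [not_dUnion_adj_inr_inl, false_iff]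
    exact fun h => hv (h.2.1.trans hw)
  · have : f v = f w ↔ v = w := hinj.eq_iff
    rw [f1 v hv, f1 w hw, Sum.inr.injEq] at this
    rw [f1 v hv, f1 w hw, dUnion_adj_inr, matching_adj, ne_eq, this]
    simp [hv]

/-- The convexity estimate for one component. -/
theorem two_mul_sub_div_le {t M m : ℝ} (h2 : 2 ≤ m) (hmM : m ≤ M) (hM : M < t) :
    (2 * m - 2) * (1 / (t - m)) ≤ 2 / (t - 2) + (m - 2) * (2 * (t - 1) / ((t - M) * (t - 2))) := by
  have e1 : 0 < t - m := by linarith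
  have e2 : 0 < t - M := by linarith
  have e3 : 0 < t - 2 := by linarith
  have : 2 / (t - 2) + (m - 2) * (2 * (t - 1) / ((t - M) * (t - 2))) -
      (2 * m - 2) * (1 / (t - m)) =
      2 * (m - 2) * (t - 1) * (M - m) / ((t - M) * (t - 2) * (t - m)) := by
    field_simp
    ring
  rw [← sub_nonneg, this]
  have e4 : 0 ≤ m - 2 := by linarith
  have e5 : 0 ≤ M - m := by linarith
  have e6 : 0 ≤ t - 1 := by linarith
  positivity

theorem eq_or_eq_of_two_mul_sub_div_eq {t M m : ℝ} (h2 : 2 ≤ m) (hmM : m ≤ M) (hM : M < t)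
    (h : (2 * m - 2) * (1 / (t - m)) =
      2 / (t - 2) + (m - 2) * (2 * (t - 1) / ((t - M) * (t - 2)))) : m = 2 ∨ m = M := by
  have e1 : 0 < t - m := by linarith
  have e2 : 0 < t - M := by linarith
  have e3 : 0 < t - 2 := by linarith
  have e4 : 0 < t - 1 := by linarith
  field_simp at h
  have : (m - 2) * ((t - 1) * (M - m)) = 0 := by linarith
  rcases mul_eq_zero.1 this with h | h
  · left; linarith
  · right
    rcases mul_eq_zero.1 h with h | h <;> linarith

theorem compOrder_le {V : Type*} [Fintype V] {F : SimpleGraph V} {k p : ℕ}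
    (h2 : ∀ C, 2 ≤ compOrder F C) (hcard : Fintype.card V = k + 2 + 2 * p)
    (hcomp : Nat.card F.ConnectedComponent = p + 1) (C : F.ConnectedComponent) :
    compOrder F C ≤ k + 2 := by
  classical
  have : Fintype F.ConnectedComponent := Fintype.ofFinite _
  have : DecidableEq F.ConnectedComponent := Classical.decEq _
  have h := sum_compOrder F
  rw [← Finset.add_sum_erase _ _ (Finset.mem_univ C)] at h
  have h3 : (Finset.univ.erase C).card • 2 ≤ ∑ D ∈ Finset.univ.erase C, compOrder F D :=
    Finset.card_nsmul_le_sum _ _ _ fun D _ => h2 D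
  rw [Finset.card_erase_of_mem (Finset.mem_univ C), Finset.card_univ,
    ← Nat.card_eq_fintype_card, hcomp, smul_eq_mul] at h3
  omega

theorem sum_chord {V : Type*} [Fintype V] {F : SimpleGraph V} [Fintype F.ConnectedComponent]
    {k p : ℕ} (hcard : Fintype.card V = k + 2 + 2 * p)
    (hcomp : Nat.card F.ConnectedComponent = p + 1) {t : ℝ} (ht : (k : ℝ) + 2 < t) :
    ∑ C : F.ConnectedComponent, (2 / (t - 2) + ((compOrder F C : ℝ) - 2) *
      (2 * (t - 1) / ((t - (k + 2)) * (t - 2)))) = starForestSum k p t := by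
  have hk : (0 : ℝ) ≤ k := k.cast_nonneg
  rw [Finset.sum_add_distrib, ← Finset.sum_mul, Finset.sum_sub_distrib, ← Nat.cast_sum,
    sum_compOrder, hcard]
  simp only [Finset.sum_const, Finset.card_univ, nsmul_eq_mul]
  rw [← Nat.card_eq_fintype_card, hcomp, starForestSum]
  have e2 : t - (k + 2) ≠ 0 := by linarith
  have e3 : t - 2 ≠ 0 := by linarith
  push_cast
  field_simp
  ring

/-- The spectral equality case forces the star forest structure. -/
theorem nonempty_iso_of_compOrder {V : Type*} [Fintype V] {F : SimpleGraph V} {k p : ℕ}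
    (hF : F.IsAcyclic) (hmin : ∀ v, 1 ≤ deg F v)
    (hcard : Fintype.card V = k + 2 + 2 * p) (hcomp : Nat.card F.ConnectedComponent = p + 1)
    (hord : ∀ C, compOrder F C = 2 ∨ compOrder F C = k + 2)
    (hdeg : ∀ u v, F.Adj v u → deg F v + deg F u = compOrder F (F.connectedComponentMk v)) :
    Nonempty (F ≃g dUnion (starGraph (k + 2)) (matching p)) := by
  classical
  have : Fintype F.ConnectedComponent := Fintype.ofFinite _
  have : DecidableEq F.ConnectedComponent := Classical.decEq _
  have hsum := sum_compOrder F
  have h2 := two_le_compOrder hF hmin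
  have hcomp' : Fintype.card F.ConnectedComponent = p + 1 := by
    rw [← Nat.card_eq_fintype_card, hcomp]
  obtain ⟨C₀, hC₀⟩ : ∃ C, compOrder F C = k + 2 := by
    by_contra! hno
    have hall : ∀ C, compOrder F C = 2 := fun C => (hord C).resolve_right (hno C)
    have : Nonempty F.ConnectedComponent := by
      rw [← Fintype.card_pos_iff, hcomp']
      omega
    have := hno (Classical.arbitrary _)
    simp only [hall, Finset.sum_const, Finset.card_univ, hcomp', smul_eq_mul] at hsum this
    omega
  have hother : ∀ C ≠ C₀, compOrder F C = 2 := by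
    rw [← Finset.add_sum_erase _ _ (Finset.mem_univ C₀)] at hsum
    have h3 : ∑ D ∈ Finset.univ.erase C₀, 2 = ∑ D ∈ Finset.univ.erase C₀, compOrder F D := by
      rw [Finset.sum_const, Finset.card_erase_of_mem (Finset.mem_univ C₀), Finset.card_univ,
        hcomp', smul_eq_mul]
      omega
    intro C hC
    exact ((Finset.sum_eq_sum_iff_of_le fun D _ => h2 D).1 h3 C
      (Finset.mem_erase.2 ⟨hC, Finset.mem_univ C⟩)).symm
  have hnbr : ∀ v, ∃ u, F.Adj v u := fun v => by
    obtain ⟨⟨u, hu⟩⟩ := (Nat.card_pos_iff.1 (hmin v)).1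
    exact ⟨u, hu⟩
  have hmk : ∀ {v u}, F.Adj v u → F.connectedComponentMk v = F.connectedComponentMk u :=
    fun h => SimpleGraph.ConnectedComponent.sound h.reachable
  obtain ⟨z, hz, hzdeg⟩ : ∃ z, F.connectedComponentMk z = C₀ ∧ deg F z = k + 1 := by
    obtain ⟨v, hv, hv1⟩ : ∃ v, F.connectedComponentMk v = C₀ ∧ deg F v = 1 := by
      by_contra! hno
      have h3 := sum_deg_component hF C₀
      have h4 : Finset.card {v | F.connectedComponentMk v = C₀} • 2 ≤
          ∑ v with F.connectedComponentMk v = C₀, deg F v :=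
        Finset.card_nsmul_le_sum _ _ _ fun v hv => by
          have := hno v (Finset.mem_filter.1 hv).2
          have := hmin v
          omega
      rw [card_filter_component, smul_eq_mul] at h4
      omega
    obtain ⟨u, hu⟩ := hnbr v
    have := hdeg u v hu
    rw [hv, hC₀] at this
    exact ⟨u, by rw [← hmk hu, hv], by omega⟩
  have hzadj : ∀ v, F.connectedComponentMk v = C₀ → v ≠ z → F.Adj z v := by
    intro v hv hvz
    have hsub : insert z (F.neighborFinset z) ⊆
        ({v | F.connectedComponentMk v = C₀} : Finset V) := by
      intro w hw
      rw [Finset.mem_insert, SimpleGraph.mem_neighborFinset] at hw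
      rw [Finset.mem_filter]
      refine ⟨Finset.mem_univ w, ?_⟩
      rcases hw with rfl | hw
      · exact hz
      · rw [← hmk hw, hz]
    have heq := Finset.eq_of_subset_of_card_le hsub (by
      rw [card_filter_component, hC₀, Finset.card_insert_of_notMem (by simp),
        SimpleGraph.card_neighborFinset_eq_degree, ← deg_eq_degree, hzdeg])
    have : v ∈ insert z (F.neighborFinset z) := by simp [heq, hv]
    simpa [hvz] using this
  refine nonempty_iso_starForest F.connectedComponentMk z Quot.mk_surjective hcard hcomp
    (by rw [hz]; exact hC₀) (by rw [hz]; exact hother) fun v w => ?_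
  rw [hz]
  constructor
  · refine fun h => ⟨h.ne, hmk h, fun hv => ?_⟩
    by_contra! hne
    have := hF.cliqueFree le_rfl {z, v, w}
    rw [SimpleGraph.is3Clique_triple_iff] at this
    exact this ⟨hzadj v hv hne.1, hzadj w (by rw [← hmk h, hv]) hne.2, h⟩
  · rintro ⟨hne, hvw, hC⟩
    by_cases hv : F.connectedComponentMk v = C₀
    · rcases hC hv with rfl | rfl
      · exact hzadj w (by rw [← hvw, hv]) hne.symm
      · exact (hzadj v hv hne).symm
    · obtain ⟨u, hu⟩ := hnbr v
      suffices u = w by rwa [← this]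
      by_contra huw
      have h3 : Finset.card {v, u, w} ≤
          Finset.card {x | F.connectedComponentMk x = F.connectedComponentMk v} := by
        refine Finset.card_le_card fun x hx => ?_
        simp only [Finset.mem_insert, Finset.mem_singleton] at hx
        rw [Finset.mem_filter]
        refine ⟨Finset.mem_univ x, ?_⟩
        rcases hx with rfl | rfl | rfl
        exacts [rfl, (hmk hu).symm, hvw.symm]
      rw [card_filter_component, hother _ hv, Finset.card_eq_three.2
        ⟨v, u, w, hu.ne, hne, huw, rfl⟩] at h3
      omega

theorem stmt17 {V : Type*} [Fintype V] [DecidableEq V] (F : SimpleGraph V) (r s : ℕ)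
    (hforest : F.IsAcyclic) (hcomp : Nat.card F.ConnectedComponent = r)
    (hsize : numEdges F = s) (hmin1 : ∀ v, 1 ≤ deg F v) (hmin2 : ∃ v, deg F v = 1) :
    qIndex (cone F) ≤
      qIndex (cone (dUnion (starGraph (s - r + 2)) (matching (r - 1)))) ∧
      (qIndex (cone F) = qIndex (cone (dUnion (starGraph (s - r + 2)) (matching (r - 1)))) ↔
        Nonempty (F ≃g dUnion (starGraph (s - r + 2)) (matching (r - 1)))) := by
  classical
  have : Fintype F.ConnectedComponent := Fintype.ofFinite _
  have hord2 := two_le_compOrder hforest hmin1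
  have hr : 1 ≤ r := by
    obtain ⟨v, -⟩ := hmin2
    have : Nonempty F.ConnectedComponent := ⟨F.connectedComponentMk v⟩
    rw [← hcomp]
    exact Nat.card_pos
  have hcard : Fintype.card V = s - r + 2 + 2 * (r - 1) := by
    have h1 := card_eq_numEdges_add hforest
    have h2 := Finset.card_nsmul_le_sum Finset.univ (compOrder F) 2 fun C _ => hord2 C
    rw [sum_compOrder, smul_eq_mul, Finset.card_univ, ← Nat.card_eq_fintype_card] at h2
    omega
  obtain ⟨p, rfl⟩ := Nat.exists_eq_add_of_le' hr
  rw [Nat.add_sub_cancel] at hcard ⊢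
  generalize s - (p + 1) = k at hcard ⊢
  obtain ⟨t, ht, hroot⟩ := exists_root k p
  rw [qIndex_starForest ht hroot]
  have hk : (0 : ℝ) ≤ k := k.cast_nonneg
  have ht0 : 0 < t := by linarith
  set m : V → ℝ := fun v => compOrder F (F.connectedComponentMk v) with hm
  have hle : ∀ C, (compOrder F C : ℝ) ≤ k + 2 := fun C => by
    exact_mod_cast compOrder_le hord2 hcard hcomp C
  have h2le : ∀ C, (2 : ℝ) ≤ compOrder F C := fun C => by exact_mod_cast hord2 C
  have hmt : ∀ v, m v < t := fun v => (hle _).trans_lt ht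
  have hconst : ∀ u v, F.Adj u v → m u = m v := fun u v h => by
    simp only [hm, SimpleGraph.ConnectedComponent.sound h.reachable]
  have hchord : ∀ C ∈ Finset.univ, (2 * (compOrder F C : ℝ) - 2) * (1 / (t - compOrder F C)) ≤
      2 / (t - 2) + ((compOrder F C : ℝ) - 2) * (2 * (t - 1) / ((t - (k + 2)) * (t - 2))) :=
    fun C _ => two_mul_sub_div_le (h2le C) (hle C) ht
  have hdegsum : ∑ v, deg F v / (t - m v) =
      ∑ C, (2 * (compOrder F C : ℝ) - 2) * (1 / (t - compOrder F C)) := by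
    rw [← sum_deg_mul_component hforest fun C => 1 / (t - compOrder F C)]
    simp only [hm, mul_one_div]
  have hslack : ∀ v, ∀ u ∈ Finset.univ, 0 ≤ if F.Adj v u then
      2 / t * ((m v - (deg F v + deg F u)) / (t - m v)) else 0 := by
    intro v u _
    split_ifs with h
    · have h1 := sub_pos.2 (hmt v)
      have h2 : (0 : ℝ) ≤ m v - (deg F v + deg F u) := by
        rw [sub_nonneg]
        simp only [hm]
        exact_mod_cast deg_add_deg_le hforest h
      positivity
    · rfl
  have hsuper : ∀ o, signlessOp (cone F) (coneVector F m t) o ≤ (t + 1) * coneVector F m t o := by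
    rintro (_ | v)
    · rw [signlessOp_cone_coneVector_none, hcard, hdegsum, ← hroot]
      simp only [coneVector, Option.elim, mul_one]
      gcongr
      rw [← sum_chord hcard hcomp ht]
      exact Finset.sum_le_sum hchord
    · rw [signlessOp_cone_coneVector_some]
      have h1 := signlessOp_degVector ht0 hmt hconst v
      have h2 := Finset.sum_nonneg (hslack v)
      simp only [coneVector, Option.elim]
      linarith
  have hpos := coneVector_pos (G := F) ht0 hmt
  refine ⟨qIndex_le_of_supersolution (by linarith) hpos hsuper, fun heq => ?_, ?_⟩
  · obtain ⟨x, hx0, hx⟩ := exists_eigenvector_of_qIndex_eq (by linarith) heq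
    have hsol : ∀ o, signlessOp (cone F) (coneVector F m t) o = (t + 1) * coneVector F m t o :=
      fun o => supersolution_eq hx hpos hsuper o
        (cone_eigenvector_ne_zero hx0 (supersolution_abs_eq hx hpos hsuper) o)
    refine nonempty_iso_of_compOrder hforest hmin1 hcard hcomp (fun C => ?_) fun u v huv => ?_
    · have h1 := hsol none
      rw [signlessOp_cone_coneVector_none, hcard, hdegsum] at h1
      simp only [coneVector, Option.elim, mul_one] at h1
      rw [← hroot, add_right_inj, mul_right_inj' (by positivity), ← sum_chord hcard hcomp ht] at h1
      have h2 := (Finset.sum_eq_sum_iff_of_le hchord).1 h1 C (Finset.mem_univ C)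
      exact_mod_cast eq_or_eq_of_two_mul_sub_div_eq (h2le C) (hle C) ht h2
    · have h1 := hsol (some v)
      have h2 := signlessOp_degVector ht0 hmt hconst v
      rw [signlessOp_cone_coneVector_some] at h1
      simp only [coneVector, Option.elim] at h1
      have h3 : (∑ u, if F.Adj v u then
          2 / t * ((m v - (deg F v + deg F u)) / (t - m v)) else 0) = 0 := by linarith
      rw [Finset.sum_eq_zero_iff_of_nonneg (hslack v)] at h3
      have h4 := h3 u (Finset.mem_univ u)
      rw [if_pos huv] at h4
      have h5 := sub_pos.2 (hmt v)
      have h6 : m v - (deg F v + deg F u) = 0 := by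
        simpa [ht0.ne', h5.ne'] using h4
      have h7 : (deg F v + deg F u : ℝ) = m v := by linarith
      simp only [hm] at h7
      exact_mod_cast h7
  · rintro ⟨e⟩
    rw [qIndex_congr (coneIso e), qIndex_starForest ht hroot]

end QPaper
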